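/- arXiv:2304.09978 — 10 statements merged into one kernel-verified Lean document; each statement's English description precedes it below -/
import Mathlib

section
/- Fix a player p of an N-player normal-form game with finite nonempty strategy sets A_1,…,A_N and joint strategy set A = ∏_q A_q. The linear map T^CCE_p from the real vector space of functions A → ℝ to the real vector space of functions A_p × A → ℝ, defined by (T^CCE_p G)(a'_p, a) = G(a'_p, a_{-p}) − G(a), has rank equal to |A| − |A_{-p}|, where |A_{-p}| = ∏_{q≠p} |A_q|. -/
open Finset

/-- The linear operator taking a payoff `G : A → ℝ` to its CCE deviation gains
`(a'ₚ, a) ↦ G (a'ₚ, a₋ₚ) − G a`. -/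
noncomputable def TcceMap {N : ℕ} (A : Fin N → Type*) [∀ q, Fintype (A q)]
    (p : Fin N) :
    ((∀ q, A q) → ℝ) →ₗ[ℝ] ((A p × (∀ q, A q)) → ℝ) where
  toFun G := fun x => G (Function.update x.2 p x.1) - G x.2
  map_add' G H := by
    funext x
    simp only [Pi.add_apply]
    ring
  map_smul' c G := by
    funext x
    simp only [Pi.smul_apply, smul_eq_mul, RingHom.id_apply]
    ring

/-- The kernel of `TcceMap A p` consists of the payoffs that ignore player `p`'s strategy. -/
theorem ker_TcceMap {N : ℕ} (A : Fin N → Type*) [∀ q, Fintype (A q)] [∀ q, Nonempty (A q)]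
    (p : Fin N) :
    LinearMap.ker (TcceMap A p) =
      LinearMap.range (LinearMap.funLeft ℝ ℝ
        (fun (a : ∀ q, A q) (j : {q : Fin N // q ≠ p}) => a j)) := by
  ext G
  rw [LinearMap.mem_ker, LinearMap.mem_range]
  constructor
  · intro hG
    refine ⟨fun b => G ((Equiv.piSplitAt p A).symm (Classical.arbitrary (A p), b)), ?_⟩
    funext a
    have h : G (Function.update a p (Classical.arbitrary (A p))) - G a = 0 :=
      congrFun hG (Classical.arbitrary (A p), a)
    rw [← sub_eq_zero.mp h, LinearMap.funLeft_apply]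
    congr 1
  · rintro ⟨H, rfl⟩
    funext x
    change H _ - H _ = 0
    rw [sub_eq_zero]
    congr 1
    funext j
    exact Function.update_of_ne j.2 _ _

/-- The kernel of `TcceMap A p` has dimension `|A₋ₚ|`. -/
theorem finrank_ker_TcceMap {N : ℕ} (A : Fin N → Type*) [∀ q, Fintype (A q)]
    [∀ q, Nonempty (A q)] (p : Fin N) :
    Module.finrank ℝ (LinearMap.ker (TcceMap A p)) =
      ∏ q ∈ univ.erase p, Fintype.card (A q) := by
  have hsurj : Function.Surjective
      (fun (a : ∀ q, A q) (j : {q : Fin N // q ≠ p}) => a j) := fun b =>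
    ⟨(Equiv.piSplitAt p A).symm (Classical.arbitrary (A p), b), by
      funext j
      simp [Equiv.piSplitAt, j.2]⟩
  rw [ker_TcceMap, LinearMap.finrank_range_of_inj
    (LinearMap.funLeft_injective_of_surjective ℝ ℝ _ hsurj), Module.finrank_fintype_fun_eq_card,
    Fintype.card_pi]
  exact (Finset.prod_subtype _ (by simp) fun q => Fintype.card (A q)).symm

/-- **Rank of the CCE deviation-gain operator.**
For any player `p`, the linear map `T^CCE_p` has rank `|A| − |A₋ₚ|`,
where `|A₋ₚ| = ∏_{q ≠ p} |A_q|`. -/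
theorem rank_TcceMap
    {N : ℕ} (A : Fin N → Type*) [∀ q, Fintype (A q)] [∀ q, Nonempty (A q)]
    (p : Fin N) :
    Module.finrank ℝ (LinearMap.range (TcceMap A p)) =
      Fintype.card (∀ q, A q) - ∏ q ∈ univ.erase p, Fintype.card (A q) := by
  have h := LinearMap.finrank_range_add_finrank_ker (TcceMap A p)
  rw [finrank_ker_TcceMap, Module.finrank_fintype_fun_eq_card] at h
  omega
end

section
/- Fix a player p of an N-player normal-form game with finite nonempty strategy sets A_1,…,A_N and joint strategy set A = ∏_q A_q. The linear map T^CE_p from the real vector space of functions A → ℝ to the real vector space of functions A_p × A_p × A → ℝ, defined by (T^CE_p G)(a'_p, a''_p, a) = G(a'_p, a_{-p}) − G(a) if a_p = a''_p and 0 otherwise, has rank equal to |A| − |A_{-p}|, where |A_{-p}| = ∏_{q≠p} |A_q|. -/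
open Finset

/-- The linear operator taking a payoff `G : A → ℝ` to its CE deviation gains
`(a'ₚ, a''ₚ, a) ↦ if aₚ = a''ₚ then G (a'ₚ, a₋ₚ) − G a else 0`. -/
noncomputable def TceMap {N : ℕ} (A : Fin N → Type*) [∀ q, Fintype (A q)]
    [∀ q, DecidableEq (A q)] (p : Fin N) :
    ((∀ q, A q) → ℝ) →ₗ[ℝ] ((A p × A p × (∀ q, A q)) → ℝ) where
  toFun G := fun x =>
    if x.2.2 p = x.2.1 then G (Function.update x.2.2 p x.1) - G x.2.2 else 0
  map_add' G H := by
    funext x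
    by_cases h : x.2.2 p = x.2.1
    · simp only [Pi.add_apply, h, if_true]
      ring
    · simp [h]
  map_smul' c G := by
    funext x
    by_cases h : x.2.2 p = x.2.1
    · simp only [Pi.smul_apply, smul_eq_mul, RingHom.id_apply, h, if_true]
      ring
    · simp [h]

/-- A payoff has vanishing deviation gains iff it does not depend on player `p`'s strategy. -/
theorem mem_ker_TceMap {N : ℕ} (A : Fin N → Type*) [∀ q, Fintype (A q)]
    [∀ q, DecidableEq (A q)] (p : Fin N) (G : (∀ q, A q) → ℝ) :
    G ∈ LinearMap.ker (TceMap A p) ↔ ∀ a b, G (Function.update a p b) = G a := by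
  rw [LinearMap.mem_ker]
  constructor
  · intro h a b
    have := congrFun h (b, a p, a)
    simpa [TceMap, sub_eq_zero] using this
  · intro h
    funext x
    simp [TceMap, h]

/-- The kernel of the deviation-gain operator consists of the pullbacks of functions of the
opponents' strategies. -/
theorem ker_TceMap {N : ℕ} (A : Fin N → Type*) [∀ q, Fintype (A q)] [∀ q, Nonempty (A q)]
    [∀ q, DecidableEq (A q)] (p : Fin N) :
    LinearMap.ker (TceMap A p) =
      LinearMap.range (LinearMap.funLeft ℝ ℝ
        (fun (a : ∀ q, A q) (q : {q // q ≠ p}) => a q)) := by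
  ext G
  rw [mem_ker_TceMap]
  constructor
  · intro h
    obtain ⟨b⟩ := ‹∀ q, Nonempty (A q)› p
    refine ⟨fun c => G ((Equiv.piSplitAt p A).symm (b, c)), ?_⟩
    funext a
    rw [LinearMap.funLeft_apply, ← h a b]
    rfl
  · rintro ⟨g, rfl⟩ a b
    simp only [LinearMap.funLeft_apply]
    congr 1
    funext q
    exact Function.update_of_ne q.2 b a

/-- The nullity of the deviation-gain operator is `|A₋ₚ|`. -/
theorem finrank_ker_TceMap {N : ℕ} (A : Fin N → Type*) [∀ q, Fintype (A q)]
    [∀ q, Nonempty (A q)] [∀ q, DecidableEq (A q)] (p : Fin N) :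
    Module.finrank ℝ (LinearMap.ker (TceMap A p)) =
      ∏ q ∈ univ.erase p, Fintype.card (A q) := by
  have hsurj : Function.Surjective
      (fun (a : ∀ q, A q) (q : {q // q ≠ p}) => a q) := by
    intro c
    obtain ⟨b⟩ := ‹∀ q, Nonempty (A q)› p
    refine ⟨(Equiv.piSplitAt p A).symm (b, c), ?_⟩
    funext q
    simp [q.2]
  rw [ker_TceMap, LinearMap.finrank_range_of_inj
    (LinearMap.funLeft_injective_of_surjective ℝ ℝ _ hsurj),
    Module.finrank_fintype_fun_eq_card, Fintype.card_pi]
  exact (Finset.prod_subtype _ (by simp) fun q => Fintype.card (A q)).symm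

/-- **Rank of the CE deviation-gain operator.**
For any player `p`, the linear map `T^CE_p` has rank `|A| − |A₋ₚ|`,
where `|A₋ₚ| = ∏_{q ≠ p} |A_q|`. -/
theorem rank_TceMap
    {N : ℕ} (A : Fin N → Type*) [∀ q, Fintype (A q)] [∀ q, Nonempty (A q)]
    [∀ q, DecidableEq (A q)] (p : Fin N) :
    Module.finrank ℝ (LinearMap.range (TceMap A p)) =
      Fintype.card (∀ q, A q) - ∏ q ∈ univ.erase p, Fintype.card (A q) := by
  have h := (TceMap A p).finrank_range_add_finrank_ker
  rw [finrank_ker_TceMap, Module.finrank_fintype_fun_eq_card] at h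
  exact Nat.eq_sub_of_add_eq h
end

section
/- Let G be an N-player normal-form game, ε : Fin N → ℝ, and σ a joint distribution that is an ε-CE of G. For each player q let s_q : A_q → ℝ be a strictly positive per-strategy scale, and define the transformed game Ĝ by Ĝ_p(a) = (∏_{q≠p} s_q(a_q))·G_p(a). Let Z = Σ_{a∈A} σ(a)/∏_q s_q(a_q) and define σ̂(a) = σ(a)/(Z·∏_q s_q(a_q)). Then σ̂ is a joint distribution (nonnegative and summing to 1), and for every player p and all a'_p, a''_p ∈ A_p with a'_p ≠ a''_p: Σ_{a∈A with a_p = a''_p} σ̂(a)·(Ĝ_p(a'_p, a_{-p}) − Ĝ_p(a)) ≤ ε_p/(Z·s_p(a''_p)). -/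
open Finset

/-- **Per-strategy-scale transform for ε-CEs.**
If `σ` is an `ε`-CE of `G` and each player's payoff is scaled per-strategy by
`Ĝ p a = (∏_{q ≠ p} s q (a q)) * G p a` with `s q (a_q) > 0`, then the rescaled joint
`σ̂ a = σ a / (Z * ∏ q, s q (a q))` with `Z = ∑ a, σ a / ∏ q, s q (a q)` is a joint
distribution satisfying the CE inequalities of `Ĝ` with slacks `ε p / (Z * s p a''ₚ)`. -/
theorem per_strategy_scale_CE
    {N : ℕ} {A : Fin N → Type*} [∀ q, Fintype (A q)] [∀ q, Nonempty (A q)]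
    [∀ q, DecidableEq (A q)]
    (G : Fin N → (∀ q, A q) → ℝ) (ε : Fin N → ℝ)
    (σ : (∀ q, A q) → ℝ)
    (hσ0 : ∀ a, 0 ≤ σ a) (hσ1 : ∑ a, σ a = 1)
    (hCE : ∀ (p : Fin N) (a' a'' : A p), a' ≠ a'' →
      ∑ a ∈ univ.filter (fun a => a p = a''),
        σ a * (G p (Function.update a p a') - G p a) ≤ ε p)
    (s : ∀ q : Fin N, A q → ℝ) (hs : ∀ q x, 0 < s q x)
    (Z : ℝ) (hZ : Z = ∑ a : ∀ q, A q, σ a / ∏ q, s q (a q))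
    (σhat : (∀ q, A q) → ℝ)
    (hσhat : ∀ a, σhat a = σ a / (Z * ∏ q, s q (a q))) :
    (∀ a, 0 ≤ σhat a) ∧ (∑ a, σhat a = 1) ∧
    ∀ (p : Fin N) (a' a'' : A p), a' ≠ a'' →
      ∑ a ∈ univ.filter (fun a => a p = a''),
        σhat a *
          ((∏ q ∈ univ.erase p, s q (Function.update a p a' q)) * G p (Function.update a p a')
            - (∏ q ∈ univ.erase p, s q (a q)) * G p a)
        ≤ ε p / (Z * s p a'') := by
  have hprod (a : ∀ q, A q) : 0 < ∏ q, s q (a q) := prod_pos fun q _ => hs q (a q)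
  have hZ_pos : 0 < Z := by
    obtain ⟨a, -, ha⟩ : ∃ a ∈ univ, σ a ≠ 0 :=
      exists_ne_zero_of_sum_ne_zero (by rw [hσ1]; exact one_ne_zero)
    rw [hZ]
    exact sum_pos' (fun b _ => div_nonneg (hσ0 b) (hprod b).le)
      ⟨a, mem_univ a, div_pos ((hσ0 a).lt_of_ne' ha) (hprod a)⟩
  refine ⟨fun a => ?_, ?_, fun p a' a'' hne => ?_⟩
  · rw [hσhat]
    exact div_nonneg (hσ0 a) (mul_pos hZ_pos (hprod a)).le
  · simp_rw [hσhat, mul_comm Z, ← div_div]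
    rw [← sum_div, ← hZ, div_self hZ_pos.ne']
  · have hscale : 0 < Z * s p a'' := mul_pos hZ_pos (hs p a'')
    calc
      _ = ∑ a ∈ univ.filter (fun a => a p = a''),
          σ a * (G p (Function.update a p a') - G p a) / (Z * s p a'') := by
        refine sum_congr rfl fun a ha => ?_
        obtain rfl : a p = a'' := (mem_filter.mp ha).2
        have hupdate : ∏ q ∈ univ.erase p, s q (Function.update a p a' q) =
            ∏ q ∈ univ.erase p, s q (a q) :=
          prod_congr rfl fun q hq => by rw [Function.update_of_ne (ne_of_mem_erase hq)]
        have hothers : ∏ q ∈ univ.erase p, s q (a q) ≠ 0 :=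
          (prod_pos fun q _ => hs q (a q)).ne'
        have hp : s p (a p) ≠ 0 := (hs p (a p)).ne'
        have hZ_ne : Z ≠ 0 := hZ_pos.ne'
        rw [hσhat, hupdate, ← mul_prod_erase univ (fun q => s q (a q)) (mem_univ p)]
        field_simp
      _ = (∑ a ∈ univ.filter (fun a => a p = a''),
          σ a * (G p (Function.update a p a') - G p a)) / (Z * s p a'') :=
        (sum_div _ _ _).symm
      _ ≤ ε p / (Z * s p a'') := div_le_div_of_nonneg_right (hCE p a' a'' hne) hscale.le
end

section
/- Let G be an N-player normal-form game, ε : Fin N → ℝ, and (σ_p)_p a mixed-strategy profile that is an ε-NE of G. For each player q let s_q : A_q → ℝ be a strictly positive per-strategy scale, and define the transformed game Ĝ by Ĝ_p(a) = (∏_{q≠p} s_q(a_q))·G_p(a). For each player p let Z_p = Σ_{a_p∈A_p} σ_p(a_p)/s_p(a_p) and define σ̂_p(a_p) = σ_p(a_p)/(Z_p·s_p(a_p)). Then each σ̂_p is a mixed strategy (nonnegative and summing to 1), and, with Z = ∏_q Z_q, for every player p and all a'_p, a''_p ∈ A_p with a'_p ≠ a''_p: Σ_{a∈A with a_p = a''_p}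 (∏_q σ̂_q(a_q))·(Ĝ_p(a'_p, a_{-p}) − Ĝ_p(a)) ≤ ε_p/(Z·s_p(a''_p)). -/
open Finset

/-- **Per-strategy-scale transform for ε-NEs.**
If the mixed-strategy profile `σ` is an `ε`-NE of `G` (the product joint is an `ε`-CE),
and each player's payoff is scaled per-strategy by
`Ĝ p a = (∏_{q ≠ p} s q (a q)) * G p a` with `s q (a_q) > 0`, then the rescaled
marginals `σ̂ p x = σ p x / (Z p * s p x)` with `Z p = ∑ x, σ p x / s p x` are mixed
strategies whose product satisfies the CE inequalities of `Ĝ` with slacks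
`ε p / ((∏ q, Z q) * s p a''ₚ)`. -/
theorem per_strategy_scale_NE
    {N : ℕ} {A : Fin N → Type*} [∀ q, Fintype (A q)] [∀ q, Nonempty (A q)]
    [∀ q, DecidableEq (A q)]
    (G : Fin N → (∀ q, A q) → ℝ) (ε : Fin N → ℝ)
    (σ : ∀ p : Fin N, A p → ℝ)
    (hσ0 : ∀ p x, 0 ≤ σ p x) (hσ1 : ∀ p, ∑ x, σ p x = 1)
    (hNE : ∀ (p : Fin N) (a' a'' : A p), a' ≠ a'' →
      ∑ a ∈ univ.filter (fun a => a p = a''),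
        (∏ q, σ q (a q)) * (G p (Function.update a p a') - G p a) ≤ ε p)
    (s : ∀ q : Fin N, A q → ℝ) (hs : ∀ q x, 0 < s q x)
    (Zp : Fin N → ℝ) (hZp : ∀ p, Zp p = ∑ x : A p, σ p x / s p x)
    (σhat : ∀ p : Fin N, A p → ℝ)
    (hσhat : ∀ p x, σhat p x = σ p x / (Zp p * s p x)) :
    (∀ p x, 0 ≤ σhat p x) ∧ (∀ p, ∑ x, σhat p x = 1) ∧
    ∀ (p : Fin N) (a' a'' : A p), a' ≠ a'' →
      ∑ a ∈ univ.filter (fun a => a p = a''),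
        (∏ q, σhat q (a q)) *
          ((∏ q ∈ univ.erase p, s q (Function.update a p a' q)) * G p (Function.update a p a')
            - (∏ q ∈ univ.erase p, s q (a q)) * G p a)
        ≤ ε p / ((∏ q, Zp q) * s p a'') := by
  have hZ : ∀ p, 0 < Zp p := by
    intro p
    rw [hZp]
    refine Finset.sum_pos' (fun x _ => div_nonneg (hσ0 p x) (hs p x).le) ?_
    by_contra! h
    have hzero : ∀ x, σ p x = 0 := fun x =>
      le_antisymm (by simpa using (div_le_iff₀ (hs p x)).1 (h x (mem_univ x))) (hσ0 p x)
    simpa [hzero] using hσ1 p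
  refine ⟨fun p x => ?_, fun p => ?_, fun p a' a'' hne => ?_⟩
  · rw [hσhat]
    exact div_nonneg (hσ0 p x) (mul_pos (hZ p) (hs p x)).le
  · have hterm : ∀ x, σhat p x = σ p x / s p x / Zp p := fun x => by
      rw [hσhat, mul_comm, div_div]
    simp only [hterm]
    rw [← Finset.sum_div, ← hZp, div_self (hZ p).ne']
  · have hprodZ : 0 < ∏ q, Zp q := Finset.prod_pos fun q _ => hZ q
    have hscale : 0 < (∏ q, Zp q) * s p a'' := mul_pos hprodZ (hs p a'')
    refine le_trans (le_of_eq ?_) (div_le_div_of_nonneg_right (hNE p a' a'' hne) hscale.le)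
    rw [Finset.sum_div]
    refine Finset.sum_congr rfl fun a ha => ?_
    have hap : a p = a'' := (Finset.mem_filter.1 ha).2
    have hupdate : ∏ q ∈ univ.erase p, s q (Function.update a p a' q)
        = ∏ q ∈ univ.erase p, s q (a q) :=
      Finset.prod_congr rfl fun q hq => by
        rw [Function.update_of_ne (Finset.ne_of_mem_erase hq)]
    have hsplit : ∏ q, s q (a q) = s p a'' * ∏ q ∈ univ.erase p, s q (a q) := by
      rw [← hap]
      exact (Finset.mul_prod_erase univ (fun q => s q (a q)) (mem_univ p)).symm
    have hothers : 0 < ∏ q ∈ univ.erase p, s q (a q) := Finset.prod_pos fun q _ => hs q (a q)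
    have hown := hs p a''
    rw [hupdate]
    simp only [hσhat]
    rw [Finset.prod_div_distrib, Finset.prod_mul_distrib, hsplit]
    field_simp
end

section
/- For an N-player normal-form game in which every player has exactly two strategies (A_p has cardinality 2 for every p), a joint distribution σ is an ε-CCE of G if and only if it is an ε-CE of G, for any ε : Fin N → ℝ. -/
open Finset

/-- If `x ≠ y` are the only two strategies of player `p`, then deviating to `x` changes something
only where `p` plays `y`, so the deviation gain is carried by those joint strategies. -/
theorem sum_filter_deviation_gain_eq_sum {ι : Type*} [Fintype ι] [DecidableEq ι] {A : ι → Type*}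
    [∀ p, Fintype (A p)] [∀ p, DecidableEq (A p)] (u σ : (∀ q, A q) → ℝ) {p : ι}
    (hA : Fintype.card (A p) = 2) {x y : A p} (hxy : x ≠ y) :
    ∑ a ∈ univ.filter (fun a => a p = y), σ a * (u (Function.update a p x) - u a) =
      ∑ a, σ a * (u (Function.update a p x) - u a) := by
  have huniv : ({x, y} : Finset (A p)) = univ :=
    Finset.eq_univ_of_card _ (by rw [Finset.card_pair hxy, hA])
  refine Finset.sum_subset (Finset.filter_subset _ _) fun a _ ha => ?_
  have hmem : a p ∈ ({x, y} : Finset (A p)) := huniv ▸ Finset.mem_univ _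
  have hax : a p = x := by simpa [show a p ≠ y by simpa using ha] using hmem
  rw [← hax, Function.update_eq_self, sub_self, mul_zero]

/-- **Two-strategy (C)CE equivalence.**
In an `N`-player game where every player has exactly two strategies, a joint
distribution `σ` is an `ε`-CCE if and only if it is an `ε`-CE. -/
theorem two_strategy_CCE_iff_CE
    {N : ℕ} {A : Fin N → Type*} [∀ p, Fintype (A p)] [∀ p, Nonempty (A p)]
    [∀ p, DecidableEq (A p)]
    (hA : ∀ p, Fintype.card (A p) = 2)
    (G : Fin N → (∀ q, A q) → ℝ) (ε : Fin N → ℝ)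
    (σ : (∀ q, A q) → ℝ)
    (hσ0 : ∀ a, 0 ≤ σ a) (hσ1 : ∑ a, σ a = 1) :
    (∀ (p : Fin N) (a' : A p),
      ∑ a, σ a * (G p (Function.update a p a') - G p a) ≤ ε p) ↔
    (∀ (p : Fin N) (a' a'' : A p), a' ≠ a'' →
      ∑ a ∈ univ.filter (fun a => a p = a''),
        σ a * (G p (Function.update a p a') - G p a) ≤ ε p) := by
  constructor
  · intro h p x y hxy
    exact (sum_filter_deviation_gain_eq_sum (G p) σ (hA p) hxy).trans_le (h p x)
  · intro h p x
    obtain ⟨y, hyx⟩ := Fintype.exists_ne_of_one_lt_card (by rw [hA p]; norm_num) x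
    exact (sum_filter_deviation_gain_eq_sum (G p) σ (hA p) hyx.symm).symm.trans_le
      (h p x y hyx.symm)
end

section
/- Every nontrivial 2×2 game can be mapped by an affine equilibrium-invariant transform onto the two-angle parameterized form: if G_1, G_2 : Fin 2 × Fin 2 → ℝ are both nontrivial (G_1 is nontrivial if there exists a_2 with G_1(0,a_2) ≠ G_1(1,a_2), and G_2 is nontrivial if there exists a_1 with G_2(a_1,0) ≠ G_2(a_1,1)), then there exist angles θ_1, θ_2 ∈ ℝ, offsets b_1, b_2 : Fin 2 → ℝ, and scales s_1, s_2 > 0 such that for all (a_1, a_2) ∈ Fin 2 × Fin 2: s_1·(G_1(a_1,a_2) + b_1(a_2)) = G^equil_1(θ_1)(a_1,a_2) and s_2·(G_2(a_1,a_2) + b_2(a_1)) = G^equil_2(θ_2)(a_1,a_2). -/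
/-- Player 1's equilibrium-invariant embedding payoff for angle `θ`. -/
noncomputable def Gequil1 (θ : ℝ) : Matrix (Fin 2) (Fin 2) ℝ :=
  !![Real.sin (θ + Real.pi / 4) / Real.sqrt 2, Real.cos (θ + Real.pi / 4) / Real.sqrt 2;
     -(Real.sin (θ + Real.pi / 4) / Real.sqrt 2), -(Real.cos (θ + Real.pi / 4) / Real.sqrt 2)]

/-- Player 2's equilibrium-invariant embedding payoff for angle `θ`. -/
noncomputable def Gequil2 (θ : ℝ) : Matrix (Fin 2) (Fin 2) ℝ :=
  !![Real.sin (θ + Real.pi / 4) / Real.sqrt 2, -(Real.sin (θ + Real.pi / 4) / Real.sqrt 2);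
     Real.cos (θ + Real.pi / 4) / Real.sqrt 2, -(Real.cos (θ + Real.pi / 4) / Real.sqrt 2)]

theorem exists_scale_mul_eq_sin_cos {x y : ℝ} (h : x ≠ 0 ∨ y ≠ 0) :
    ∃ θ s : ℝ, 0 < s ∧ s * x = Real.sin (θ + Real.pi / 4) / Real.sqrt 2 ∧
      s * y = Real.cos (θ + Real.pi / 4) / Real.sqrt 2 := by
  set z : ℂ := ⟨y, x⟩
  have hz : z ≠ 0 := by
    intro hz
    have hy : y = 0 := congrArg Complex.re hz
    have hx : x = 0 := congrArg Complex.im hz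
    tauto
  have hn : 0 < ‖z‖ := norm_pos_iff.mpr hz
  refine ⟨z.arg - Real.pi / 4, (‖z‖ * Real.sqrt 2)⁻¹, by positivity, ?_, ?_⟩
  · rw [sub_add_cancel, Complex.sin_arg]
    change _ = x / _ / _
    field_simp
  · rw [sub_add_cancel, Complex.cos_arg hz]
    change _ = y / _ / _
    field_simp

/-- A pair of payoff rows differing somewhere can be centred columnwise and rescaled so that the
rows become opposite vectors at a given angle. -/
theorem exists_centred_scale (f g : Fin 2 → ℝ) (h : ∃ i, f i ≠ g i) :
    ∃ (θ : ℝ) (b : Fin 2 → ℝ) (s : ℝ), 0 < s ∧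
      s * (f 0 + b 0) = Real.sin (θ + Real.pi / 4) / Real.sqrt 2 ∧
      s * (f 1 + b 1) = Real.cos (θ + Real.pi / 4) / Real.sqrt 2 ∧
      s * (g 0 + b 0) = -(Real.sin (θ + Real.pi / 4) / Real.sqrt 2) ∧
      s * (g 1 + b 1) = -(Real.cos (θ + Real.pi / 4) / Real.sqrt 2) := by
  have hd : (f 0 - g 0) / 2 ≠ 0 ∨ (f 1 - g 1) / 2 ≠ 0 := by
    simpa [Fin.exists_fin_two, sub_eq_zero] using h
  obtain ⟨θ, s, hs, hsin, hcos⟩ := exists_scale_mul_eq_sin_cos hd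
  refine ⟨θ, fun i => -(f i + g i) / 2, s, hs, ?_, ?_, ?_, ?_⟩
  · rw [← hsin]; ring
  · rw [← hcos]; ring
  · rw [← hsin]; ring
  · rw [← hcos]; ring

/-- **2×2 equilibrium-invariant embedding.**
Every nontrivial 2×2 game can be mapped by an affine equilibrium-invariant transform
onto the two-angle parameterized form `(Gequil1 θ₁, Gequil2 θ₂)`. -/
theorem equilibrium_invariant_embedding_2x2
    (G1 G2 : Fin 2 → Fin 2 → ℝ)
    (h1 : ∃ a2, G1 0 a2 ≠ G1 1 a2)
    (h2 : ∃ a1, G2 a1 0 ≠ G2 a1 1) :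
    ∃ (θ1 θ2 : ℝ) (b1 b2 : Fin 2 → ℝ) (s1 s2 : ℝ),
      0 < s1 ∧ 0 < s2 ∧
      (∀ a1 a2, s1 * (G1 a1 a2 + b1 a2) = Gequil1 θ1 a1 a2) ∧
      (∀ a1 a2, s2 * (G2 a1 a2 + b2 a1) = Gequil2 θ2 a1 a2) := by
  obtain ⟨θ1, b1, s1, hs1, h00, h01, h10, h11⟩ := exists_centred_scale (G1 0) (G1 1) h1
  obtain ⟨θ2, b2, s2, hs2, k00, k10, k01, k11⟩ :=
    exists_centred_scale (fun a => G2 a 0) (fun a => G2 a 1) h2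
  refine ⟨θ1, θ2, b1, b2, s1, s2, hs1, hs2, ?_, ?_⟩
  · simpa [Fin.forall_fin_two, Gequil1] using ⟨⟨h00, h01⟩, h10, h11⟩
  · simpa [Fin.forall_fin_two, Gequil2] using ⟨⟨k00, k01⟩, k10, k11⟩
end

section
/- If θ_1, θ_2 ∈ ℝ satisfy sin(θ_1)·sin(θ_2) < 0, then the 2×2 game (G^equil_1(θ_1), G^equil_2(θ_2)) is invariant-zero-sum: there exist a scale s_2 > 0 and offsets b_1 : Fin 2 → ℝ (a function of player 2's strategy) and b_2 : Fin 2 → ℝ (a function of player 1's strategy) such that for all (a_1, a_2) ∈ Fin 2 × Fin 2: (G^equil_1(θ_1)(a_1,a_2) + b_1(a_2)) + (s_2·G^equil_2(θ_2)(a_1,a_2) + b_2(a_1)) = 0. -/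
theorem sin_add_pi_div_four_div_sqrt_two (θ : ℝ) :
    Real.sin (θ + Real.pi / 4) / Real.sqrt 2 = (Real.cos θ + Real.sin θ) / 2 := by
  have h2 : Real.sqrt 2 ≠ 0 := by positivity
  rw [Real.sin_add, Real.cos_pi_div_four, Real.sin_pi_div_four]
  field_simp
  ring

theorem cos_add_pi_div_four_div_sqrt_two (θ : ℝ) :
    Real.cos (θ + Real.pi / 4) / Real.sqrt 2 = (Real.cos θ - Real.sin θ) / 2 := by
  have h2 : Real.sqrt 2 ≠ 0 := by positivity
  rw [Real.cos_add, Real.cos_pi_div_four, Real.sin_pi_div_four]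
  field_simp

/-- **Invariant-zero-sum quadrants.**
If `sin θ₁ · sin θ₂ < 0`, the game `(Gequil1 θ₁, Gequil2 θ₂)` is invariant-zero-sum. -/
theorem invariant_zero_sum_quadrants
    (θ1 θ2 : ℝ) (h : Real.sin θ1 * Real.sin θ2 < 0) :
    ∃ (s2 : ℝ) (b1 b2 : Fin 2 → ℝ),
      0 < s2 ∧
      ∀ a1 a2, (Gequil1 θ1 a1 a2 + b1 a2) + (s2 * Gequil2 θ2 a1 a2 + b2 a1) = 0 := by
  have hθ2 : Real.sin θ2 ≠ 0 := right_ne_zero_of_mul h.ne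
  have hs : 0 < -Real.sin θ1 / Real.sin θ2 := by
    have hdiv : -Real.sin θ1 / Real.sin θ2 =
        -(Real.sin θ1 * Real.sin θ2) / Real.sin θ2 ^ 2 := by
      field_simp
    rw [hdiv]
    exact div_pos (neg_pos.mpr h) (by positivity)
  obtain ⟨s, hs_eq⟩ : ∃ s, s = -Real.sin θ1 / Real.sin θ2 := ⟨_, rfl⟩
  have hmul : s * Real.sin θ2 = -Real.sin θ1 := by rw [hs_eq, div_mul_cancel₀ _ hθ2]
  refine ⟨s, fun j => -(Gequil1 θ1 0 j + s * Gequil2 θ2 0 j),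
    fun i => (Gequil1 θ1 0 0 + s * Gequil2 θ2 0 0) - (Gequil1 θ1 i 0 + s * Gequil2 θ2 i 0),
    hs_eq ▸ hs, fun a1 a2 => ?_⟩
  fin_cases a1 <;> fin_cases a2 <;>
    simp [Gequil1, Gequil2, sin_add_pi_div_four_div_sqrt_two,
      cos_add_pi_div_four_div_sqrt_two] <;>
    linarith
end

section
/- For any θ^A, θ^B ∈ [−π, π]: (i) the entrywise inner product Σ_{(a_1,a_2)∈Fin 2×Fin 2} G^equil_1(θ^A)(a_1,a_2)·G^equil_1(θ^B)(a_1,a_2) equals cos(θ^A − θ^B), and (ii) arccos(cos(θ^A − θ^B)) = min(|θ^A − θ^B|, 2π − |θ^A − θ^B|). Hence the per-player component of the equilibrium-invariant distance between two 2×2 games equals the arc length between their angle parameters on the unit circle. -/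
theorem sum_Gequil1_mul_Gequil1 (θ φ : ℝ) :
    ∑ a1 : Fin 2, ∑ a2 : Fin 2, Gequil1 θ a1 a2 * Gequil1 φ a1 a2 = Real.cos (θ - φ) := by
  have h2 : Real.sqrt 2 ^ 2 = 2 := Real.sq_sqrt zero_le_two
  rw [← add_sub_add_right_eq_sub θ φ (Real.pi / 4), Real.cos_sub]
  simp only [Gequil1, Fin.sum_univ_two, Matrix.of_apply, Matrix.cons_val', Matrix.cons_val_zero,
    Matrix.cons_val_one, Matrix.cons_val_fin_one]
  field_simp
  rw [h2]
  ring

theorem Real.arccos_cos_eq_min {x : ℝ} (hx : |x| ≤ 2 * Real.pi) :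
    Real.arccos (Real.cos x) = min |x| (2 * Real.pi - |x|) := by
  rw [← Real.cos_abs]
  rcases le_total |x| Real.pi with h | h
  · rw [Real.arccos_cos (abs_nonneg x) h, min_eq_left (by linarith)]
  · rw [← Real.cos_two_pi_sub, Real.arccos_cos (by linarith) (by linarith),
      min_eq_right (by linarith)]

/-- **2×2 equilibrium-invariant distance metric (per-player component).**
For angles in `[−π, π]`, the entrywise inner product of the embedded payoffs is
`cos (θᴬ − θᴮ)`, and `arccos (cos (θᴬ − θᴮ))` equals the arc length
`min |θᴬ − θᴮ| (2π − |θᴬ − θᴮ|)`. -/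
theorem equilibrium_invariant_distance_2x2
    (θA θB : ℝ)
    (hA : θA ∈ Set.Icc (-Real.pi) Real.pi)
    (hB : θB ∈ Set.Icc (-Real.pi) Real.pi) :
    (∑ a1 : Fin 2, ∑ a2 : Fin 2, Gequil1 θA a1 a2 * Gequil1 θB a1 a2
        = Real.cos (θA - θB)) ∧
    Real.arccos (Real.cos (θA - θB))
        = min |θA - θB| (2 * Real.pi - |θA - θB|) := by
  refine ⟨sum_Gequil1_mul_Gequil1 θA θB, Real.arccos_cos_eq_min ?_⟩
  rw [abs_le]
  constructor <;> linarith [hA.1, hA.2, hB.1, hB.2]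
end

section
/- Permuting player 1's two strategies corresponds to the parameter transformation (θ_1, θ_2) → (θ_1 + π, −θ_2) of the equilibrium-invariant embedding: for every θ_1, θ_2 ∈ ℝ and all (a_1, a_2) ∈ Fin 2 × Fin 2, G^equil_1(θ_1)(swap(a_1), a_2) = G^equil_1(θ_1 + π)(a_1, a_2) and G^equil_2(θ_2)(swap(a_1), a_2) = G^equil_2(−θ_2)(a_1, a_2), where swap : Fin 2 → Fin 2 exchanges 0 and 1. -/
/-- The permutation of the two strategies, exchanging `0` and `1` in `Fin 2`. -/
def swapFin2 : Fin 2 → Fin 2 := fun i => if i = 0 then 1 else 0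

/-- **Player 1 strategy permutation symmetry.**
Permuting player 1's two strategies corresponds to the parameter transformation
`(θ₁, θ₂) → (θ₁ + π, −θ₂)` of the equilibrium-invariant embedding. -/
theorem player1_strategy_permutation_symmetry
    (θ1 θ2 : ℝ) (a1 a2 : Fin 2) :
    Gequil1 θ1 (swapFin2 a1) a2 = Gequil1 (θ1 + Real.pi) a1 a2 ∧
    Gequil2 θ2 (swapFin2 a1) a2 = Gequil2 (-θ2) a1 a2 := by
  have hsin : Real.sin (θ1 + Real.pi + Real.pi / 4) = -Real.sin (θ1 + Real.pi / 4) := by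
    rw [add_right_comm, Real.sin_add_pi]
  have hcos : Real.cos (θ1 + Real.pi + Real.pi / 4) = -Real.cos (θ1 + Real.pi / 4) := by
    rw [add_right_comm, Real.cos_add_pi]
  have hsin' : Real.sin (-θ2 + Real.pi / 4) = Real.cos (θ2 + Real.pi / 4) := by
    rw [← Real.sin_pi_div_two_sub]
    ring_nf
  have hcos' : Real.cos (-θ2 + Real.pi / 4) = Real.sin (θ2 + Real.pi / 4) := by
    rw [← Real.cos_pi_div_two_sub]
    ring_nf
  fin_cases a1 <;> fin_cases a2 <;>
    simp [Gequil1, Gequil2, swapFin2, hsin, hcos, hsin', hcos', neg_div]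
end

section
/- Permuting player 2's two strategies corresponds to the parameter transformation (θ_1, θ_2) → (−θ_1, θ_2 + π) of the equilibrium-invariant embedding: for every θ_1, θ_2 ∈ ℝ and all (a_1, a_2) ∈ Fin 2 × Fin 2, G^equil_1(θ_1)(a_1, swap(a_2)) = G^equil_1(−θ_1)(a_1, a_2) and G^equil_2(θ_2)(a_1, swap(a_2)) = G^equil_2(θ_2 + π)(a_1, a_2), where swap : Fin 2 → Fin 2 exchanges 0 and 1. -/
/-- Negating `θ` exchanges the sine and the cosine of `θ + π / 4`. -/
theorem sin_neg_add_pi_div_four (θ : ℝ) :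
    Real.sin (-θ + Real.pi / 4) = Real.cos (θ + Real.pi / 4) := by
  rw [← Real.sin_pi_div_two_sub]
  congr 1
  ring

theorem cos_neg_add_pi_div_four (θ : ℝ) :
    Real.cos (-θ + Real.pi / 4) = Real.sin (θ + Real.pi / 4) := by
  simpa using (sin_neg_add_pi_div_four (-θ)).symm

/-- **Player 2 strategy permutation symmetry.**
Permuting player 2's two strategies corresponds to the parameter transformation
`(θ₁, θ₂) → (−θ₁, θ₂ + π)` of the equilibrium-invariant embedding. -/
theorem player2_strategy_permutation_symmetry
    (θ1 θ2 : ℝ) (a1 a2 : Fin 2) :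
    Gequil1 θ1 a1 (swapFin2 a2) = Gequil1 (-θ1) a1 a2 ∧
    Gequil2 θ2 a1 (swapFin2 a2) = Gequil2 (θ2 + Real.pi) a1 a2 := by
  have shift : θ2 + Real.pi + Real.pi / 4 = θ2 + Real.pi / 4 + Real.pi := by ring
  fin_cases a1 <;> fin_cases a2 <;>
    simp [Gequil1, Gequil2, swapFin2, sin_neg_add_pi_div_four, cos_neg_add_pi_div_four, shift,
      neg_div]
end
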